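/- If u : ℝ → ℝ is a function on an interval whose distributional derivative is a non-positive Radon measure, then u agrees almost everywhere with a non-increasing function of bounded variation. -/

import Mathlib

open MeasureTheory

/-- An antitone function on a subset `S` of `Ioo a b` that is dense in `Ioo a b` extends to an
antitone function on `Ioo a b`. -/
theorem AntitoneOn.exists_antitoneOn_Ioo_extension {u : ℝ → ℝ} {a b : ℝ} {S : Set ℝ}
    (hu : AntitoneOn u S)
    (hdense : ∀ x y, a ≤ x → x < y → y ≤ b → (S ∩ Set.Ioo x y).Nonempty) :
    ∃ v : ℝ → ℝ, AntitoneOn v (Set.Ioo a b) ∧ ∀ x ∈ S ∩ Set.Ioo a b, u x = v x := by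
  have hbdd : ∀ x ∈ Set.Ioo a b, BddAbove (u '' (S ∩ Set.Ici x)) := by
    intro x hx
    obtain ⟨s, hs, hs'⟩ := hdense a x le_rfl hx.1 hx.2.le
    refine ⟨u s, ?_⟩
    rintro _ ⟨t, ⟨ht, ht'⟩, rfl⟩
    exact hu hs ht (hs'.2.le.trans ht')
  refine ⟨fun x => sSup (u '' (S ∩ Set.Ici x)), ?_, ?_⟩
  · intro x hx y hy hxy
    obtain ⟨s, hs, hs'⟩ := hdense y b hy.1.le hy.2 le_rfl
    exact csSup_le_csSup (hbdd x hx) ⟨u s, s, ⟨hs, hs'.1.le⟩, rfl⟩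
      (Set.image_mono (Set.inter_subset_inter_right S (Set.Ici_subset_Ici.2 hxy)))
  · rintro x ⟨hxS, hx⟩
    refine le_antisymm (le_csSup (hbdd x hx) ⟨x, ⟨hxS, Set.self_mem_Ici⟩, rfl⟩)
      (csSup_le ⟨u x, x, ⟨hxS, Set.self_mem_Ici⟩, rfl⟩ ?_)
    rintro _ ⟨t, ⟨ht, ht'⟩, rfl⟩
    exact hu hxS ht ht'

/-- If the distributional derivative of `u` on `Ioo a b` is non-positive, then averages of `u`
against translates of a smooth non-negative kernel decrease as the kernel moves to the right. -/
theorem integral_mul_translate_sub_nonneg_of_nonpos_distributional_derivative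
    {u ρ : ℝ → ℝ} {a b x y ε : ℝ}
    (hder : ∀ φ : ℝ → ℝ, ContDiff ℝ (⊤ : ℕ∞) φ → HasCompactSupport φ →
        tsupport φ ⊆ Set.Ioo a b → (∀ x, 0 ≤ φ x) →
        0 ≤ ∫ x, u x * deriv φ x)
    (hρ : ContDiff ℝ (⊤ : ℕ∞) ρ) (hρ_nonneg : ∀ t, 0 ≤ ρ t) (hρ_zero : ∀ t, ε ≤ |t| → ρ t = 0)
    (hxy : x ≤ y) (hax : a < x - ε) (hyb : y + ε < b) :
    0 ≤ ∫ t, u t * (ρ (t - x) - ρ (t - y)) := by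
  have hint : ∀ p q, IntervalIntegrable ρ volume p q := hρ.continuous.intervalIntegrable
  set ψ : ℝ → ℝ := fun t => (∫ s in (0 : ℝ)..(t - x), ρ s) - ∫ s in (0 : ℝ)..(t - y), ρ s with hψ
  have hψ_eq : ∀ t, ψ t = ∫ s in (t - y)..(t - x), ρ s := fun t =>
    intervalIntegral.integral_interval_sub_left (hint _ _) (hint _ _)
  have hψ_deriv : ∀ t, HasDerivAt ψ (ρ (t - x) - ρ (t - y)) t := by
    intro t
    exact ((hρ.continuous.integral_hasStrictDerivAt 0 (t - x)).hasDerivAt.comp_sub_const t x).sub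
      ((hρ.continuous.integral_hasStrictDerivAt 0 (t - y)).hasDerivAt.comp_sub_const t y)
  have hderiv_eq : deriv ψ = fun t => ρ (t - x) - ρ (t - y) := funext fun t => (hψ_deriv t).deriv
  have hψ_zero : ∀ t, t ∉ Set.Icc (x - ε) (y + ε) → ψ t = 0 := by
    intro t ht
    rw [hψ_eq, intervalIntegral.integral_congr (g := fun _ => (0 : ℝ))]
    · simp
    · intro s hs
      rw [Set.uIcc_of_le (by linarith)] at hs
      apply hρ_zero
      by_cases h : x - ε ≤ t
      · have : y + ε < t := by
          by_contra! h'
          exact ht ⟨h, h'⟩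
        exact (by linarith [hs.1] : ε ≤ s).trans (le_abs_self s)
      · exact (by linarith [hs.2] : ε ≤ -s).trans (neg_le_abs s)
  have hsupp : tsupport ψ ⊆ Set.Icc (x - ε) (y + ε) :=
    closure_minimal (fun t ht => by_contra fun h => ht (hψ_zero t h)) isClosed_Icc
  have key := hder ψ
    (contDiff_infty_iff_deriv.2 ⟨fun t => (hψ_deriv t).differentiableAt, by
      rw [hderiv_eq]
      exact (hρ.comp (contDiff_id.sub contDiff_const)).sub
        (hρ.comp (contDiff_id.sub contDiff_const))⟩)
    (HasCompactSupport.intro isCompact_Icc hψ_zero)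
    (hsupp.trans (Set.Icc_subset_Ioo hax hyb))
    (fun t => by
      rw [hψ_eq]
      exact intervalIntegral.integral_nonneg (by linarith) fun s _ => hρ_nonneg s)
  rwa [hderiv_eq] at key

open scoped Convolution in
/-- If the distributional derivative of `u` on `Ioo a b` is non-positive, then mollifications of
`u` are antitone away from the endpoints. -/
theorem convolution_normed_le_of_nonpos_distributional_derivative
    {u : ℝ → ℝ} {a b c d x y : ℝ}
    (hu : LocallyIntegrableOn u (Set.Ioo a b))
    (hder : ∀ φ : ℝ → ℝ, ContDiff ℝ (⊤ : ℕ∞) φ → HasCompactSupport φ →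
        tsupport φ ⊆ Set.Ioo a b → (∀ x, 0 ≤ φ x) →
        0 ≤ ∫ x, u x * deriv φ x)
    (f : ContDiffBump (0 : ℝ)) (hac : a < c) (hdb : d < b)
    (hxy : x ≤ y) (hcx : c ≤ x - f.rOut) (hyd : y + f.rOut ≤ d) :
    (f.normed volume ⋆[ContinuousLinearMap.lsmul ℝ ℝ, volume] (Set.Icc c d).indicator u) y ≤
      (f.normed volume ⋆[ContinuousLinearMap.lsmul ℝ ℝ, volume] (Set.Icc c d).indicator u) x := by
  have hw : LocallyIntegrable ((Set.Icc c d).indicator u) :=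
    ((hu.integrableOn_compact_subset (Set.Icc_subset_Ioo hac hdb)
      isCompact_Icc).integrable_indicator measurableSet_Icc).locallyIntegrable
  have hρ_zero : ∀ t, f.rOut ≤ |t| → f.normed volume t = 0 := by
    intro t ht
    rw [← Function.notMem_support, f.support_normed_eq]
    simpa using ht
  have hconv : ∀ z, (f.normed volume ⋆[ContinuousLinearMap.lsmul ℝ ℝ, volume]
      (Set.Icc c d).indicator u) z = ∫ t, (Set.Icc c d).indicator u t * f.normed volume (t - z) := by
    intro z
    rw [convolution_lsmul_swap]
    congr 1 with t
    rw [← f.normed_neg, neg_sub, smul_eq_mul, mul_comm]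
  have hint : ∀ z, Integrable fun t => (Set.Icc c d).indicator u t * f.normed volume (t - z) := by
    intro z
    refine hw.integrable_smul_right_of_hasCompactSupport
      (f.continuous_normed.comp (continuous_id.sub continuous_const)) ?_
    exact f.hasCompactSupport_normed.comp_homeomorph (Homeomorph.subRight z)
  have key := integral_mul_translate_sub_nonneg_of_nonpos_distributional_derivative hder
    f.contDiff_normed (fun t => f.nonneg_normed t) hρ_zero hxy (hac.trans_le hcx)
    (hyd.trans_lt hdb)
  rw [hconv, hconv, ← sub_nonneg, ← integral_sub (hint x) (hint y)]
  refine key.trans_eq (integral_congr_ae (ae_of_all _ fun t => ?_))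
  by_cases ht : t ∈ Set.Icc c d
  · simp only [Set.indicator_of_mem ht, mul_sub]
  · have hzero : ∀ z, x ≤ z → z ≤ y → f.normed volume (t - z) = 0 := by
      intro z hz hz'
      apply hρ_zero
      by_cases h : c ≤ t
      · have : d < t := by
          by_contra! h'
          exact ht ⟨h, h'⟩
        exact (by linarith : f.rOut ≤ t - z).trans (le_abs_self _)
      · exact (by linarith : f.rOut ≤ -(t - z)).trans (neg_le_abs _)
    simp [hzero x le_rfl hxy, hzero y hxy le_rfl]

/-- If the distributional derivative of a locally integrable `u` on an open interval `I = Ioo a b`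
is a non-positive distribution (equivalently a non-positive Radon measure), then `u` agrees almost
everywhere on `I` with a non-increasing function (in particular a function of locally bounded
variation). -/
theorem ae_antitone_version_of_nonpos_distributional_derivative
    (u : ℝ → ℝ) (a b : ℝ) (hab : a < b)
    (hu : LocallyIntegrableOn u (Set.Ioo a b))
    -- non-positivity of the distributional derivative: ⟨u', φ⟩ = −∫ u φ' ≤ 0 for φ ≥ 0 :
    (hder : ∀ φ : ℝ → ℝ, ContDiff ℝ (⊤ : ℕ∞) φ → HasCompactSupport φ →
        tsupport φ ⊆ Set.Ioo a b → (∀ x, 0 ≤ φ x) →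
        0 ≤ ∫ x, u x * deriv φ x) :
    ∃ v : ℝ → ℝ, AntitoneOn v (Set.Ioo a b) ∧
      (∀ᵐ x, x ∈ Set.Ioo a b → u x = v x) := by
  obtain ⟨c, -, hc, hc_lim⟩ := exists_seq_strictAnti_tendsto' hab
  obtain ⟨d, -, hd, hd_lim⟩ := exists_seq_strictMono_tendsto' hab
  let f : ℕ → ContDiffBump (0 : ℝ) := fun n =>
    ⟨1 / ((n : ℝ) + 1), 2 * (1 / ((n : ℝ) + 1)), by positivity, by
      have : 0 < 1 / ((n : ℝ) + 1) := by positivity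
      linarith⟩
  have hf : Filter.Tendsto (fun n => (f n).rOut) Filter.atTop (nhds 0) := by
    simpa [f] using (tendsto_one_div_add_atTop_nhds_zero_nat (𝕜 := ℝ)).const_mul 2
  have hlim : ∀ᵐ x, ∀ n, Filter.Tendsto (fun i => convolution ((f i).normed volume)
      ((Set.Icc (c n) (d n)).indicator u) (ContinuousLinearMap.lsmul ℝ ℝ) volume x)
      Filter.atTop (nhds ((Set.Icc (c n) (d n)).indicator u x)) := by
    refine ae_all_iff.2 fun n => ContDiffBump.ae_convolution_tendsto_right_of_locallyIntegrable
      (K := 2) hf (Filter.Eventually.of_forall fun i => le_rfl) ?_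
    exact ((hu.integrableOn_compact_subset (Set.Icc_subset_Ioo (hc n).1 (hd n).2)
      isCompact_Icc).integrable_indicator measurableSet_Icc).locallyIntegrable
  let G : Set ℝ := {x | ∀ n, Filter.Tendsto (fun i => convolution ((f i).normed volume)
      ((Set.Icc (c n) (d n)).indicator u) (ContinuousLinearMap.lsmul ℝ ℝ) volume x)
      Filter.atTop (nhds ((Set.Icc (c n) (d n)).indicator u x))}
  have hanti : AntitoneOn u (G ∩ Set.Ioo a b) := by
    rintro x ⟨hxG, hx⟩ y ⟨hyG, hy⟩ hxy
    obtain ⟨n, hn, hn'⟩ := ((hc_lim.eventually_lt_const hx.1).and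
      (hd_lim.eventually_const_lt hy.2)).exists
    have hle := le_of_tendsto_of_tendsto (hyG n) (hxG n) (by
      filter_upwards [hf.eventually_lt_const (sub_pos.2 hn), hf.eventually_lt_const (sub_pos.2 hn')]
        with i hi hi'
      exact convolution_normed_le_of_nonpos_distributional_derivative hu hder (f i) (hc n).1
        (hd n).2 hxy (by linarith) (by linarith))
    rwa [Set.indicator_of_mem (Set.mem_Icc.2 ⟨by linarith, hn'.le⟩),
      Set.indicator_of_mem (Set.mem_Icc.2 ⟨hn.le, by linarith⟩)] at hle
  have hdense : Dense G := Measure.dense_of_ae hlim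
  obtain ⟨v, hv, huv⟩ := hanti.exists_antitoneOn_Ioo_extension (a := a) (b := b) (by
    intro x y hax hxy hyb
    obtain ⟨s, hs, hsG⟩ := hdense.inter_open_nonempty _ isOpen_Ioo (Set.nonempty_Ioo.2 hxy)
    exact ⟨s, ⟨hsG, hax.trans_lt hs.1, hs.2.trans_le hyb⟩, hs⟩)
  refine ⟨v, hv, ?_⟩
  filter_upwards [hlim] with x hx hx'
  exact huv x ⟨⟨hx, hx'⟩, hx'⟩
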